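/- There exists a constant c > 0 such that for all integers n ≥ c and 1 ≤ k ≤ n/c the following holds. Set r = ⌈c·n/log(n/k)⌉, let X = {x_1,…,x_r} ∪ {y_1,…,y_r}, let H consist of the all-zero function h⋆ together with, for each i ∈ {1,…,r}, the function h_i that is 1 exactly on {x_i, y_i}, and let D be uniform on {x_1,…,x_r}. Draw a clean sample C ∼ D^n and let the adversary output one copy of y_i for every i ∈ {1,…,r} such that x_i appears in C. Let h_S be the (randomized) output of the OIG predictor for H with orientation rule O*_rand, trained on the points of C together with the adversarial points, all labeled 0 by h⋆. Then E[ err_{D,h⋆}(h_S) ] ≥ k·log(n/k)/(c·n). -/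

import Mathlib

open Classical

noncomputable section

/-- `v ∈ {0,1}^M` is a vertex of the one-inclusion graph of `H` on `z_1, …, z_M`. -/
def IsOIGVertex {X : Type*} (H : Set (X → Bool)) {M : ℕ} (z : Fin M → X)
    (v : Fin M → Bool) : Prop :=
  ∃ h ∈ H, ∀ i, h (z i) = v i

/-- `u, v` is an edge of the one-inclusion graph: both are vertices and they differ
in exactly one coordinate. -/
def IsOIGEdge {X : Type*} (H : Set (X → Bool)) {M : ℕ} (z : Fin M → X)
    (u v : Fin M → Bool) : Prop :=
  IsOIGVertex H z u ∧ IsOIGVertex H z v ∧ (∃! i, u i ≠ v i)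

/-- An orientation of the one-inclusion graph, encoded as a finite set `σ` of ordered
pairs: `(u, v) ∈ σ` means the edge `{u, v}` is assigned to the endpoint `v` (so it
counts towards the out-degree of `u`). -/
def IsOrientation {X : Type*} (H : Set (X → Bool)) {M : ℕ} (z : Fin M → X)
    (σ : Finset ((Fin M → Bool) × (Fin M → Bool))) : Prop :=
  (∀ p ∈ σ, IsOIGEdge H z p.1 p.2) ∧
  ∀ u v : Fin M → Bool, IsOIGEdge H z u v → ((u, v) ∈ σ ↔ (v, u) ∉ σ)

/-- The maximum out-degree of an orientation. -/
def maxOutDeg {M : ℕ} (σ : Finset ((Fin M → Bool) × (Fin M → Bool))) : ℕ :=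
  Finset.univ.sup fun u : Fin M → Bool => (σ.filter fun p => p.1 = u).card

/-- `σ` is an orientation minimizing the maximum out-degree. -/
def MinimizesMaxOutDeg {X : Type*} (H : Set (X → Bool)) {M : ℕ} (z : Fin M → X)
    (σ : Finset ((Fin M → Bool) × (Fin M → Bool))) : Prop :=
  IsOrientation H z σ ∧
  ∀ σ', IsOrientation H z σ' → maxOutDeg σ ≤ maxOutDeg σ'

/-- The one-inclusion graph predictor (training points followed by the test point). -/
def oigPredict {X : Type*} (H : Set (X → Bool)) {N : ℕ} (z : Fin (N + 1) → X)
    (σ : Finset ((Fin (N + 1) → Bool) × (Fin (N + 1) → Bool))) (b : Fin N → Bool) :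
    Bool :=
  if IsOIGVertex H z (Fin.snoc b false) ∧ IsOIGVertex H z (Fin.snoc b true) then
    decide ((Fin.snoc b false, Fin.snoc b true) ∈ σ)
  else if IsOIGVertex H z (Fin.snoc b true) then true
  else false

/-- The class on `X = {1,…,r} × {0,1}` (with `x_i = (i, false)`, `y_i = (i, true)`)
consisting of the all-zero target `h⋆` and, for each `i`, the hypothesis `h_i` that is
`1` exactly on `{x_i, y_i}`. -/
def Hcl (r : ℕ) : Set (Fin r × Bool → Bool) :=
  {f | f = (fun _ => false) ∨ ∃ i : Fin r, f = fun p => decide (p.1 = i)}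

/-- The training points: the clean sample `x_{C 1}, …, x_{C n}` followed by one
adversarial point `y_i` for each `i` appearing in `C` (listed in increasing order). -/
def train (n r : ℕ) (C : Fin n → Fin r) :
    Fin (n + (Finset.image C Finset.univ).card) → Fin r × Bool :=
  Fin.append (fun j => (C j, false))
    (fun j => (((Finset.image C Finset.univ).orderIsoOfFin rfl j).1, true))

lemma Hcl_apply_eq_of_fst_eq {r : ℕ} {f : Fin r × Bool → Bool} (hf : f ∈ Hcl r)
    {p q : Fin r × Bool} (h : p.1 = q.1) : f p = f q := by
  rcases hf with rfl | ⟨i, rfl⟩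
  · rfl
  · simp [h]

lemma Hcl_eq_of_apply_eq_true {r : ℕ} {f : Fin r × Bool → Bool} (hf : f ∈ Hcl r)
    {p : Fin r × Bool} (h : f p = true) : f = fun q => decide (q.1 = p.1) := by
  rcases hf with rfl | ⟨i, rfl⟩
  · simp at h
  · have : p.1 = i := by simpa using h
    rw [this]

section UniqueEdge

variable {r N : ℕ} {t : Fin N → Fin r × Bool} {i : Fin r}

lemma isOIGVertex_snoc_false (t : Fin N → Fin r × Bool) (i : Fin r) :
    IsOIGVertex (Hcl r) (Fin.snoc t (i, false) : Fin (N + 1) → Fin r × Bool)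
      (Fin.snoc (fun _ => false) false) := by
  refine ⟨fun _ => false, Or.inl rfl, fun a => ?_⟩
  refine Fin.lastCases ?_ (fun a => ?_) a <;> simp

lemma isOIGVertex_snoc_true (hne : ∀ a, (t a).1 ≠ i) :
    IsOIGVertex (Hcl r) (Fin.snoc t (i, false) : Fin (N + 1) → Fin r × Bool)
      (Fin.snoc (fun _ => false) true) := by
  refine ⟨fun p => decide (p.1 = i), Or.inr ⟨i, rfl⟩, fun a => ?_⟩
  refine Fin.lastCases ?_ (fun a => ?_) a <;> simp [hne]

lemma eq_snoc_of_vertex_of_last (hne : ∀ a, (t a).1 ≠ i) {f g : Fin r × Bool → Bool}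
    (hf : f ∈ Hcl r) (hfi : f (i, false) = true) (hgi : g (i, false) = false)
    (hfg : ∀ a, f (t a) = g (t a)) {u v : Fin (N + 1) → Bool}
    (hu : ∀ a, f ((Fin.snoc t (i, false) : Fin (N + 1) → Fin r × Bool) a) = u a)
    (hv : ∀ a, g ((Fin.snoc t (i, false) : Fin (N + 1) → Fin r × Bool) a) = v a) :
    u = Fin.snoc (fun _ => false) true ∧ v = Fin.snoc (fun _ => false) false := by
  have hft : ∀ a, f (t a) = false := fun a => by
    rw [Hcl_eq_of_apply_eq_true hf hfi]; simp [hne]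
  constructor
  · funext a
    rw [← hu]
    refine Fin.lastCases ?_ (fun a => ?_) a <;> simp [hft, hfi]
  · funext a
    rw [← hv]
    refine Fin.lastCases ?_ (fun a => ?_) a <;> simp [← hfg, hft, hgi]

/-- If every training point has a twin with the same index and none has index `i`, the
one-inclusion graph has a single edge. -/
lemma isOIGEdge_snoc_iff (htwin : ∀ a, ∃ b, b ≠ a ∧ (t b).1 = (t a).1)
    (hne : ∀ a, (t a).1 ≠ i) (u v : Fin (N + 1) → Bool) :
    IsOIGEdge (Hcl r) (Fin.snoc t (i, false) : Fin (N + 1) → Fin r × Bool) u v ↔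
      (u = Fin.snoc (fun _ => false) false ∧ v = Fin.snoc (fun _ => false) true) ∨
      (u = Fin.snoc (fun _ => false) true ∧ v = Fin.snoc (fun _ => false) false) := by
  constructor
  · rintro ⟨⟨f, hf, hu⟩, ⟨g, hg, hv⟩, a, ha, huniq⟩
    have hfg : ∀ b, f (t b) = g (t b) := by
      intro b
      by_contra hb
      obtain ⟨b', hb', hbb⟩ := htwin b
      have h1 : b.castSucc = a := huniq _ (by
        change u _ ≠ v _
        rw [← hu, ← hv]; simpa using hb)
      have h2 : b'.castSucc = a := huniq _ (by
        change u _ ≠ v _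
        rw [← hu, ← hv]
        simpa [Hcl_apply_eq_of_fst_eq hf hbb, Hcl_apply_eq_of_fst_eq hg hbb] using hb)
      exact hb' (Fin.castSucc_injective _ (h2.trans h1.symm))
    have hi : f (i, false) ≠ g (i, false) := by
      intro h
      apply ha
      rw [← hu, ← hv]
      refine Fin.lastCases ?_ (fun b => ?_) a <;> simp [h, hfg]
    cases hfi : f (i, false) <;> cases hgi : g (i, false)
    · simp [hfi, hgi] at hi
    · exact Or.inl (eq_snoc_of_vertex_of_last hne hg hgi hfi (fun a => (hfg a).symm) hv hu).symm
    · exact Or.inr (eq_snoc_of_vertex_of_last hne hf hfi hgi hfg hu hv)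
    · simp [hfi, hgi] at hi
  · have key : ∃! a : Fin (N + 1), (Fin.snoc (fun _ => false) false : Fin (N + 1) → Bool) a ≠
        (Fin.snoc (fun _ => false) true : Fin (N + 1) → Bool) a := by
      refine ⟨Fin.last N, by simp, fun b => ?_⟩
      refine Fin.lastCases ?_ (fun b => ?_) b <;> simp
    rintro (⟨rfl, rfl⟩ | ⟨rfl, rfl⟩)
    · exact ⟨isOIGVertex_snoc_false t i, isOIGVertex_snoc_true hne, key⟩
    · exact ⟨isOIGVertex_snoc_true hne, isOIGVertex_snoc_false t i, by
        simpa only [ne_comm] using key⟩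

end UniqueEdge

lemma maxOutDeg_singleton {M : ℕ} (p : (Fin M → Bool) × (Fin M → Bool)) :
    maxOutDeg {p} = 1 := by
  unfold maxOutDeg
  apply le_antisymm
  · refine Finset.sup_le fun u _ => ?_
    exact (Finset.card_filter_le _ _).trans (by simp)
  · refine le_trans ?_ (Finset.le_sup (Finset.mem_univ p.1))
    simp [Finset.filter_singleton]

lemma isOrientation_iff_of_unique_edge {X : Type*} {H : Set (X → Bool)} {M : ℕ}
    {z : Fin M → X} {u₀ v₀ : Fin M → Bool} (hne : u₀ ≠ v₀)
    (hedge : ∀ u v, IsOIGEdge H z u v ↔ (u = u₀ ∧ v = v₀) ∨ (u = v₀ ∧ v = u₀))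
    (σ : Finset ((Fin M → Bool) × (Fin M → Bool))) :
    IsOrientation H z σ ↔ σ = {(u₀, v₀)} ∨ σ = {(v₀, u₀)} := by
  constructor
  · rintro ⟨h1, h2⟩
    have h3 := h2 u₀ v₀ ((hedge _ _).2 (Or.inl ⟨rfl, rfl⟩))
    have h4 : ∀ p ∈ σ, p = (u₀, v₀) ∨ p = (v₀, u₀) := fun p hp => by
      simpa [Prod.ext_iff] using (hedge _ _).1 (h1 p hp)
    by_cases h : (u₀, v₀) ∈ σ
    · left
      ext p
      rw [Finset.mem_singleton]
      refine ⟨fun hp => (h4 p hp).resolve_right ?_, fun hp => hp ▸ h⟩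
      rintro rfl
      exact h3.1 h hp
    · right
      have h' : (v₀, u₀) ∈ σ := by
        by_contra h'
        exact h (h3.2 h')
      ext p
      rw [Finset.mem_singleton]
      refine ⟨fun hp => (h4 p hp).resolve_left ?_, fun hp => hp ▸ h'⟩
      rintro rfl
      exact h hp
  · rintro (rfl | rfl)
    · refine ⟨fun p hp => ?_, fun u v huv => ?_⟩
      · rw [Finset.mem_singleton] at hp
        subst hp
        exact (hedge _ _).2 (Or.inl ⟨rfl, rfl⟩)
      · rcases (hedge _ _).1 huv with ⟨rfl, rfl⟩ | ⟨rfl, rfl⟩ <;> simp [hne, hne.symm]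
    · refine ⟨fun p hp => ?_, fun u v huv => ?_⟩
      · rw [Finset.mem_singleton] at hp
        subst hp
        exact (hedge _ _).2 (Or.inr ⟨rfl, rfl⟩)
      · rcases (hedge _ _).1 huv with ⟨rfl, rfl⟩ | ⟨rfl, rfl⟩ <;> simp [hne, hne.symm]

lemma filter_minimizesMaxOutDeg_of_unique_edge {X : Type*} {H : Set (X → Bool)} {M : ℕ}
    {z : Fin M → X} {u₀ v₀ : Fin M → Bool} (hne : u₀ ≠ v₀)
    (hedge : ∀ u v, IsOIGEdge H z u v ↔ (u = u₀ ∧ v = v₀) ∨ (u = v₀ ∧ v = u₀)) :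
    Finset.univ.filter (fun σ => MinimizesMaxOutDeg H z σ) =
      {{(u₀, v₀)}, {(v₀, u₀)}} := by
  have hor := isOrientation_iff_of_unique_edge hne hedge
  have hdeg : ∀ σ, IsOrientation H z σ → maxOutDeg σ = 1 := fun σ hσ => by
    rcases (hor σ).1 hσ with rfl | rfl <;> exact maxOutDeg_singleton _
  ext σ
  simp only [Finset.mem_filter, Finset.mem_univ, true_and, Finset.mem_insert,
    Finset.mem_singleton]
  rw [← hor]
  exact ⟨fun h => h.1, fun h => ⟨h, fun σ' h' => by rw [hdeg σ h, hdeg σ' h']⟩⟩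

/-- The probability, over the random orientation, that the predictor errs. -/
def errProb (n r : ℕ) (C : Fin n → Fin r) (i : Fin r) : ℝ :=
  (∑ σ ∈ Finset.univ.filter (fun σ =>
      MinimizesMaxOutDeg (Hcl r) (Fin.snoc (train n r C) (i, false)) σ),
    (if oigPredict (Hcl r) (Fin.snoc (train n r C) (i, false)) σ
        (fun _ => false) = true then (1 : ℝ) else 0))
  / ((Finset.univ.filter (fun σ =>
      MinimizesMaxOutDeg (Hcl r) (Fin.snoc (train n r C) (i, false)) σ)).card : ℝ)

lemma errProb_nonneg (n r : ℕ) (C : Fin n → Fin r) (i : Fin r) : 0 ≤ errProb n r C i :=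
  div_nonneg (Finset.sum_nonneg fun _ _ => by split_ifs <;> norm_num) (Nat.cast_nonneg _)

lemma train_fst_ne {n r : ℕ} {C : Fin n → Fin r} {i : Fin r} (hC : ∀ j, C j ≠ i)
    (a : Fin (n + (Finset.image C Finset.univ).card)) : (train n r C a).1 ≠ i := by
  unfold train
  refine Fin.addCases (fun j => ?_) (fun j => ?_) a
  · simpa using hC j
  · rw [Fin.append_right]
    obtain ⟨j', -, hj'⟩ := Finset.mem_image.1
      (((Finset.image C Finset.univ).orderIsoOfFin rfl j).2)
    change ((Finset.image C Finset.univ).orderIsoOfFin rfl j).1 ≠ i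
    rw [← hj']
    exact hC j'

lemma train_exists_twin {n r : ℕ} (C : Fin n → Fin r)
    (a : Fin (n + (Finset.image C Finset.univ).card)) :
    ∃ b, b ≠ a ∧ (train n r C b).1 = (train n r C a).1 := by
  unfold train
  refine Fin.addCases (fun j => ?_) (fun j => ?_) a
  · refine ⟨Fin.natAdd n (((Finset.image C Finset.univ).orderIsoOfFin rfl).symm
      ⟨C j, Finset.mem_image_of_mem C (Finset.mem_univ j)⟩), ?_, ?_⟩
    · intro h
      have := congrArg Fin.val h
      simp at this
      omega
    · rw [Fin.append_right, Fin.append_left, OrderIso.apply_symm_apply]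
  · obtain ⟨j', -, hj'⟩ := Finset.mem_image.1
      (((Finset.image C Finset.univ).orderIsoOfFin rfl j).2)
    refine ⟨Fin.castAdd _ j', ?_, ?_⟩
    · intro h
      have := congrArg Fin.val h
      simp at this
      omega
    · rw [Fin.append_right, Fin.append_left]
      exact hj'

lemma errProb_eq_half {n r : ℕ} {C : Fin n → Fin r} {i : Fin r} (hC : ∀ j, C j ≠ i) :
    errProb n r C i = 1 / 2 := by
  set N := n + (Finset.image C Finset.univ).card with hN
  have hne := train_fst_ne hC
  have h01 : (Fin.snoc (fun _ => false) false : Fin (N + 1) → Bool) ≠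
      Fin.snoc (fun _ => false) true := fun h => by
    simpa using congrFun h (Fin.last N)
  have hset : ({((Fin.snoc (fun _ => false) false : Fin (N + 1) → Bool),
      (Fin.snoc (fun _ => false) true : Fin (N + 1) → Bool))} :
        Finset ((Fin (N + 1) → Bool) × (Fin (N + 1) → Bool))) ≠
      {(Fin.snoc (fun _ => false) true, Fin.snoc (fun _ => false) false)} := fun h => by
    rw [Finset.singleton_inj, Prod.mk.injEq] at h
    exact h01 h.1
  unfold errProb
  rw [filter_minimizesMaxOutDeg_of_unique_edge h01
    (isOIGEdge_snoc_iff (train_exists_twin C) hne), Finset.sum_pair hset,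
    Finset.card_pair hset]
  have hv : IsOIGVertex (Hcl r) (Fin.snoc (train n r C) (i, false) : Fin (N + 1) → Fin r × Bool)
      (Fin.snoc (fun _ => false) false) ∧
    IsOIGVertex (Hcl r) (Fin.snoc (train n r C) (i, false) : Fin (N + 1) → Fin r × Bool)
      (Fin.snoc (fun _ => false) true) :=
    ⟨isOIGVertex_snoc_false _ i, isOIGVertex_snoc_true hne⟩
  unfold oigPredict
  rw [if_pos hv, if_pos hv, if_pos (decide_eq_true (Finset.mem_singleton_self _)),
    if_neg fun h => h01 (congrArg Prod.fst (Finset.mem_singleton.1 (of_decide_eq_true h)))]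
  norm_num

lemma card_filter_forall_ne (n r : ℕ) (i : Fin r) :
    (Finset.univ.filter fun C : Fin n → Fin r => ∀ j, C j ≠ i).card = (r - 1) ^ n := by
  have : (Finset.univ.filter fun C : Fin n → Fin r => ∀ j, C j ≠ i) =
      Fintype.piFinset fun _ => Finset.univ.erase i := by
    ext C
    simp
  rw [this, Fintype.card_piFinset]
  simp

lemma half_mul_le_sum_errProb (n r : ℕ) :
    (r : ℝ) * ((r - 1 : ℕ) : ℝ) ^ n * (1 / 2) ≤
      ∑ C : Fin n → Fin r, ∑ i : Fin r, errProb n r C i := by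
  rw [Finset.sum_comm]
  have h : ∀ i : Fin r, ((r - 1 : ℕ) : ℝ) ^ n * (1 / 2) ≤
      ∑ C : Fin n → Fin r, errProb n r C i := fun i => by
    calc ((r - 1 : ℕ) : ℝ) ^ n * (1 / 2)
        = ∑ C ∈ Finset.univ.filter (fun C : Fin n → Fin r => ∀ j, C j ≠ i),
            errProb n r C i := by
          rw [Finset.sum_congr rfl fun C hC => errProb_eq_half (Finset.mem_filter.1 hC).2,
            Finset.sum_const, card_filter_forall_ne, nsmul_eq_mul]
          push_cast
          rfl
      _ ≤ _ := Finset.sum_le_sum_of_subset_of_nonneg (Finset.filter_subset _ _)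
          fun C _ _ => errProb_nonneg n r C i
  calc (r : ℝ) * ((r - 1 : ℕ) : ℝ) ^ n * (1 / 2)
      = ∑ _i : Fin r, ((r - 1 : ℕ) : ℝ) ^ n * (1 / 2) := by simp [mul_assoc]
    _ ≤ _ := Finset.sum_le_sum fun i _ => h i

lemma exp_neg_two_mul_le_one_sub {x : ℝ} (hx0 : 0 ≤ x) (hx : x ≤ 1 / 2) :
    Real.exp (-(2 * x)) ≤ 1 - x := by
  have hpos : 0 < 1 - x := by linarith
  rw [← Real.le_log_iff_exp_le hpos]
  refine le_trans ?_ (Real.one_sub_inv_le_log_of_pos hpos)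
  have : (1 - x)⁻¹ ≤ 1 + 2 * x := by
    rw [inv_le_iff_one_le_mul₀ hpos]
    nlinarith
  linarith

lemma half_le_exp_half (L : ℝ) : L / 2 ≤ Real.exp (L / 2) := by
  linarith [Real.add_one_le_exp (L / 2)]

lemma exp_neg_mul_le_one_sub_inv_pow {n r : ℕ} {L : ℝ} (hL : 0 < L) (hr2 : 2 ≤ r)
    (hr : 4 * (n : ℝ) / L ≤ r) :
    Real.exp (-(L / 2)) ≤ (1 - 1 / (r : ℝ)) ^ n := by
  have hr2' : (2 : ℝ) ≤ r := by exact_mod_cast hr2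
  have hx : 1 / (r : ℝ) ≤ 1 / 2 := by gcongr
  calc Real.exp (-(L / 2)) ≤ Real.exp (n * (-(2 * (1 / (r : ℝ))))) := by
        apply Real.exp_le_exp.2
        have h1 : 4 * (n : ℝ) ≤ r * L := (div_le_iff₀ hL).1 hr
        have h2 : (n : ℝ) / r ≤ L / 4 := by
          rw [div_le_iff₀ (by linarith)]
          linarith
        have h3 : (n : ℝ) * (-(2 * (1 / (r : ℝ)))) = -(2 * ((n : ℝ) / r)) := by ring
        rw [h3]
        linarith
    _ = Real.exp (-(2 * (1 / (r : ℝ)))) ^ n := Real.exp_nat_mul _ _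
    _ ≤ _ := pow_le_pow_left₀ (Real.exp_pos _).le
        (exp_neg_two_mul_le_one_sub (by positivity) hx) n

/-- there is a constant `c > 0` such that for all `n ≥ c` and
`1 ≤ k ≤ n/c`, with `r = ⌈c·n/log(n/k)⌉`, in the above setting the OIG predictor with a
uniformly random maximum-out-degree-minimizing orientation `O*_rand`, trained on the
clean sample `C ∼ D^n` (with `D` uniform on `{x_1,…,x_r}`, formalized as uniform over
tuples `C : Fin n → Fin r`) together with the adversarial points, all labeled `0`, has
expected error at least `k·log(n/k)/(c·n)`; the expectation (written as a normalized
sum) is over `C`, the uniformly random test point, and the random orientation. -/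
theorem oig_lower_bound_general :
    ∃ c : ℝ, 0 < c ∧ ∀ n k : ℕ, c ≤ (n : ℝ) → 1 ≤ k → (k : ℝ) ≤ (n : ℝ) / c →
      ∀ r : ℕ, r = ⌈c * (n : ℝ) / Real.log ((n : ℝ) / (k : ℝ))⌉₊ →
      (k : ℝ) * Real.log ((n : ℝ) / (k : ℝ)) / (c * (n : ℝ)) ≤
        (∑ C : Fin n → Fin r, ∑ i : Fin r,
          (∑ σ ∈ Finset.univ.filter (fun σ =>
              MinimizesMaxOutDeg (Hcl r) (Fin.snoc (train n r C) (i, false)) σ),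
            (if oigPredict (Hcl r) (Fin.snoc (train n r C) (i, false)) σ
                (fun _ => false) = true then (1 : ℝ) else 0))
          / ((Finset.univ.filter (fun σ =>
              MinimizesMaxOutDeg (Hcl r) (Fin.snoc (train n r C) (i, false)) σ)).card : ℝ))
        / ((r : ℝ) ^ n * (r : ℝ)) := by
  refine ⟨4, by norm_num, fun n k hn hk hkn r hr => ?_⟩
  have hk' : (1 : ℝ) ≤ k := by exact_mod_cast hk
  have hn0 : (0 : ℝ) < n := by linarith
  have hk0 : (0 : ℝ) < k := by linarith
  set L := Real.log ((n : ℝ) / (k : ℝ)) with hLdef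
  have hL : 0 < L := Real.log_pos (by rw [lt_div_iff₀ hk0]; linarith)
  have hLn : L ≤ n := (Real.log_le_self (by positivity)).trans (div_le_self hn0.le hk')
  have hr4 : 4 * (n : ℝ) / L ≤ r := hr ▸ Nat.le_ceil _
  have hr2 : 2 ≤ r := by
    have h4 : (4 : ℝ) ≤ 4 * (n : ℝ) / L := by rw [le_div_iff₀ hL]; linarith
    have : (2 : ℝ) ≤ r := by linarith
    exact_mod_cast this
  have hr0 : (0 : ℝ) < r := by
    have : 0 < r := by omega
    exact_mod_cast this
  have hbound := exp_neg_mul_le_one_sub_inv_pow hL hr2 hr4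
  have hkexp : (k : ℝ) / n = Real.exp (-(L / 2)) * Real.exp (-(L / 2)) := by
    rw [← Real.exp_add, show -(L / 2) + -(L / 2) = -L by ring, Real.exp_neg, hLdef,
      Real.exp_log (by positivity), inv_div]
  have hmain : (k : ℝ) * L / (4 * n) ≤ 1 / 2 * (1 - 1 / (r : ℝ)) ^ n := by
    have h1 : Real.exp (-(L / 2)) * (L / 2) ≤ 1 := by
      calc Real.exp (-(L / 2)) * (L / 2) ≤ Real.exp (-(L / 2)) * Real.exp (L / 2) := by
            gcongr
            exact half_le_exp_half L
        _ = 1 := by rw [← Real.exp_add]; simp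
    calc (k : ℝ) * L / (4 * n) = 1 / 2 * ((k : ℝ) / n * (L / 2)) := by ring
      _ = 1 / 2 * (Real.exp (-(L / 2)) * (Real.exp (-(L / 2)) * (L / 2))) := by
          rw [hkexp, mul_assoc]
      _ ≤ 1 / 2 * (Real.exp (-(L / 2)) * 1) := by gcongr
      _ ≤ _ := by rw [mul_one]; gcongr
  refine hmain.trans ?_
  rw [le_div_iff₀ (by positivity)]
  refine le_trans (le_of_eq ?_) (half_mul_le_sum_errProb n r)
  have h2 : (1 : ℝ) - 1 / (r : ℝ) = ((r - 1 : ℕ) : ℝ) / r := by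
    rw [Nat.cast_sub (by omega)]
    field_simp
    simp
  rw [h2, div_pow]
  field_simp

end
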